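/- Let G be a unicyclic graph whose unique cycle is the odd cycle C_{2n+1} = (x_1,…,x_{2n+1}) (n ≥ 1), let I = I(G) be its edge ideal, and let l = |E(G)| − (2n+1). Then for every s with n+1 ≤ s ≤ 2n+1, the s-th symbolic defect satisfies sdefect(I, s) = ((2n+1+l) multichoose (s−(n+1))) = C(2n+l+s−(n+1), s−(n+1)). -/

import Mathlib

open MvPolynomial

noncomputable section

/-- The edge ideal of a simple graph: `I(G) = ⟨X_u · X_v : {u,v} ∈ E(G)⟩`. -/
def edgeIdeal (𝕜 : Type) [Field 𝕜] {V : Type} (G : SimpleGraph V) :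
    Ideal (MvPolynomial V 𝕜) :=
  Ideal.span {p | ∃ u v : V, G.Adj u v ∧ p = X u * X v}

/-- `G` is a unicyclic graph (connected with exactly one cycle, equivalently connected with as
many edges as vertices) whose unique cycle is the odd cycle `C_{2n+1}` on the vertices `x j`. -/
structure IsUnicyclicOddCycle {V : Type} [Fintype V] (G : SimpleGraph V) (n : ℕ)
    (x : ZMod (2 * n + 1) → V) : Prop where
  connected : G.Connected
  edge_count : G.edgeSet.ncard = Fintype.card V
  inj : Function.Injective x
  adj_iff : ∀ i j : ZMod (2 * n + 1), G.Adj (x i) (x j) ↔ (j = i + 1 ∨ i = j + 1)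

/-- `f` is a minimal monomial generator of the monomial ideal `J`: it is a monic monomial
belonging to `J` such that no monic monomial of `J` properly divides it. -/
def IsMinMonomialGen {𝕜 : Type} [Field 𝕜] {V : Type} (J : Ideal (MvPolynomial V 𝕜))
    (f : MvPolynomial V 𝕜) : Prop :=
  (∃ m : V →₀ ℕ, f = monomial m 1) ∧ f ∈ J ∧
    ∀ g : MvPolynomial V 𝕜, (∃ m : V →₀ ℕ, g = monomial m 1) → g ∈ J → g ∣ f → g = f

def localizationComap {R : Type} [CommRing R] (p : Ideal R) (hp : p.IsPrime) (J : Ideal R) :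
    Ideal R :=
  letI := hp
  Ideal.comap (algebraMap R (Localization p.primeCompl))
    (Ideal.map (algebraMap R (Localization p.primeCompl)) J)

/-- The `s`-th symbolic power `I^{(s)} = ⋂_{p ∈ Ass(R/I)} (I^s R_p ∩ R)`. -/
def symbolicPower {R : Type} [CommRing R] (I : Ideal R) (s : ℕ) : Ideal R :=
  sInf {J : Ideal R | ∃ (p : Ideal R) (hp : p.IsPrime),
    p ∈ associatedPrimes R (R ⧸ I) ∧ J = localizationComap p hp (I ^ s)}

/-- The `s`-th symbolic defect of `I`: the minimal number of generators of the module
`I^{(s)}/I^s`, i.e. the least `m` such that `I^{(s)} = I^s + (f_1, …, f_m)` for some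
`f_1, …, f_m ∈ I^{(s)}`. -/
def sdefect {R : Type} [CommRing R] (I : Ideal R) (s : ℕ) : ℕ :=
  sInf {m : ℕ | ∃ S : Finset R, S.card = m ∧ (↑S : Set R) ⊆ (symbolicPower I s : Set R) ∧
    I ^ s ⊔ Ideal.span (↑S : Set R) = symbolicPower I s}


/-! ### Structure of unicyclic graphs -/

section Structure

variable {V : Type} [Fintype V] {G : SimpleGraph V} {n : ℕ} {x : ZMod (2 * n + 1) → V}

theorem zmod_two_ne_zero (hn : 1 ≤ n) : (2 : ZMod (2 * n + 1)) ≠ 0 := by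
  intro h
  have h2 : ((2 : ℕ) : ZMod (2 * n + 1)) = 0 := by exact_mod_cast h
  rw [ZMod.natCast_eq_zero_iff] at h2
  have := Nat.le_of_dvd (by norm_num) h2
  omega

theorem exists_parent (hx : IsUnicyclicOddCycle G n x) :
    ∃ (d : V → ℕ) (p : V → V), ∀ v, v ∉ Set.range x → G.Adj v (p v) ∧ d (p v) < d v := by
  classical
  let d : V → ℕ := fun v => sInf (Set.range fun i => G.dist v (x i))
  have key : ∀ v, v ∉ Set.range x → ∃ w, G.Adj v w ∧ d w < d v := by
    intro v hv
    have hmem : d v ∈ Set.range fun i => G.dist v (x i) := Nat.sInf_mem ⟨_, ⟨0, rfl⟩⟩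
    obtain ⟨i, hi⟩ := hmem
    obtain ⟨w, hw⟩ := hx.connected.exists_walk_length_eq_dist v (x i)
    cases w with
    | nil => exact absurd ⟨i, rfl⟩ hv
    | cons h q =>
      rename_i w
      refine ⟨w, h, ?_⟩
      have h1 : d w ≤ G.dist w (x i) := Nat.sInf_le ⟨i, rfl⟩
      have h2 := SimpleGraph.dist_le q
      simp only [SimpleGraph.Walk.length_cons] at hw
      simp only at hi
      omega
  choose! p hp using key
  exact ⟨d, p, hp⟩

/-- Every edge is a cycle edge or a parent edge. -/
theorem edges_classify (hn : 1 ≤ n) (hx : IsUnicyclicOddCycle G n x)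
    (d : V → ℕ) (p : V → V) (hp : ∀ v, v ∉ Set.range x → G.Adj v (p v) ∧ d (p v) < d v) :
    ∀ u v, G.Adj u v → (u ∈ Set.range x ∧ v ∈ Set.range x) ∨ (u ∉ Set.range x ∧ v = p u) ∨
      (v ∉ Set.range x ∧ u = p v) := by
  classical
  have hinv : ∀ v ∈ Set.range x, ∃ i, x i = v := fun v h => h
  choose! idx hidx using hinv
  let f : V → Sym2 V := fun v => if v ∈ Set.range x then s(v, x (idx v + 1)) else s(v, p v)
  have hf : ∀ v, f v ∈ G.edgeSet := by
    intro v
    by_cases hv : v ∈ Set.range x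
    · simp only [f, if_pos hv, SimpleGraph.mem_edgeSet]
      have := (hx.adj_iff (idx v) (idx v + 1)).2 (Or.inl rfl)
      rwa [hidx v hv] at this
    · simp only [f, if_neg hv, SimpleGraph.mem_edgeSet]
      exact (hp v hv).1
  have hinj : Function.Injective f := by
    intro v w hvw
    by_cases hv : v ∈ Set.range x <;> by_cases hw : w ∈ Set.range x
    · simp only [f, if_pos hv, if_pos hw] at hvw
      rcases Sym2.eq_iff.1 hvw with ⟨h, -⟩ | ⟨h1, h2⟩
      · exact h
      · exfalso
        rw [← hidx v hv] at h1
        rw [← hidx w hw] at h2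
        have h1 := hx.inj h1
        have h2 := hx.inj h2
        rw [← h2] at h1
        apply zmod_two_ne_zero hn
        linear_combination -h1
    · simp only [f, if_pos hv, if_neg hw] at hvw
      rcases Sym2.eq_iff.1 hvw with ⟨h, -⟩ | ⟨h1, h2⟩
      · exact h
      · exact absurd ⟨_, h2⟩ hw
    · simp only [f, if_neg hv, if_pos hw] at hvw
      rcases Sym2.eq_iff.1 hvw with ⟨h, -⟩ | ⟨h1, h2⟩
      · exact h
      · exact absurd ⟨_, h1.symm⟩ hv
    · simp only [f, if_neg hv, if_neg hw] at hvw
      rcases Sym2.eq_iff.1 hvw with ⟨h, -⟩ | ⟨h1, h2⟩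
      · exact h
      · have a := (hp v hv).2
        have b := (hp w hw).2
        rw [h2] at a
        rw [← h1] at b
        omega
  have hsurj : Set.range f = G.edgeSet := by
    apply Set.eq_of_subset_of_ncard_le
    · rintro _ ⟨v, rfl⟩
      exact hf v
    · rw [hx.edge_count, ← Set.image_univ, Set.ncard_image_of_injective _ hinj, Set.ncard_univ,
        Nat.card_eq_fintype_card]
    · exact Set.toFinite _
  intro u v huv
  have : s(u, v) ∈ Set.range f := by rw [hsurj]; exact huv
  obtain ⟨a, ha⟩ := this
  by_cases h : a ∈ Set.range x
  · simp only [f, if_pos h] at ha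
    rcases Sym2.eq_iff.1 ha with ⟨h1, h2⟩ | ⟨h1, h2⟩
    · left; exact ⟨h1 ▸ h, ⟨_, h2⟩⟩
    · left; exact ⟨⟨_, h2⟩, h1 ▸ h⟩
  · simp only [f, if_neg h] at ha
    rcases Sym2.eq_iff.1 ha with ⟨h1, h2⟩ | ⟨h1, h2⟩
    · right; left; subst h1; exact ⟨h, h2.symm⟩
    · right; right; subst h1; exact ⟨h, h2.symm⟩

/-- A subgraph without degree one vertices is empty or the cycle. -/
theorem core_structure (hn : 1 ≤ n) (hx : IsUnicyclicOddCycle G n x) (H : SimpleGraph V)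
    (hHG : H ≤ G) (hdeg : ∀ v w, H.Adj v w → ∃ w', w' ≠ w ∧ H.Adj v w') :
    (∀ u v, H.Adj u v → ∃ i, (u = x i ∧ v = x (i + 1)) ∨ (v = x i ∧ u = x (i + 1))) ∧
    ((∃ u v, H.Adj u v) → ∀ i, H.Adj (x i) (x (i + 1))) := by
  classical
  obtain ⟨d, p, hp⟩ := exists_parent hx
  have hcl := edges_classify hn hx d p hp
  have hcyc : ∀ u v, H.Adj u v → u ∈ Set.range x := by
    by_contra hcon
    push Not at hcon
    obtain ⟨u, v, huv, hu⟩ := hcon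
    let S : Finset V := Finset.univ.filter fun v => v ∉ Set.range x ∧ ∃ w, H.Adj v w
    have hS : S.Nonempty := ⟨u, by simp only [S, Finset.mem_filter]; exact ⟨Finset.mem_univ _, hu, v, huv⟩⟩
    obtain ⟨a, haS, hamax⟩ := Finset.exists_max_image S d hS
    simp only [S, Finset.mem_filter, Finset.mem_univ, true_and] at haS
    obtain ⟨ha, b, hab⟩ := haS
    have hall : ∀ w, H.Adj a w → w = p a := by
      intro w hw
      rcases hcl a w (hHG hw) with h | h | h
      · exact absurd h.1 ha
      · exact h.2
      · exfalso
        have h1 := hamax w (by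
          simp only [S, Finset.mem_filter, Finset.mem_univ, true_and]
          exact ⟨h.1, a, hw.symm⟩)
        have h2 := (hp w h.1).2
        rw [← h.2] at h2
        omega
    obtain ⟨w', hw', hw''⟩ := hdeg a b hab
    exact hw' ((hall _ hw'').trans (hall _ hab).symm)
  have hform : ∀ u v, H.Adj u v → ∃ i, (u = x i ∧ v = x (i + 1)) ∨ (v = x i ∧ u = x (i + 1)) := by
    intro u v huv
    obtain ⟨i, rfl⟩ := hcyc u v huv
    obtain ⟨j, rfl⟩ := hcyc v _ huv.symm
    rcases (hx.adj_iff i j).1 (hHG huv) with h | h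
    · exact ⟨i, Or.inl ⟨rfl, by rw [h]⟩⟩
    · exact ⟨j, Or.inr ⟨rfl, by rw [h]⟩⟩
  refine ⟨hform, ?_⟩
  rintro ⟨u, v, huv⟩
  have hstep : ∀ i, H.Adj (x i) (x (i + 1)) → H.Adj (x (i + 1)) (x (i + 1 + 1)) := by
    intro i hi
    obtain ⟨w', hne, hw'⟩ := hdeg _ _ hi.symm
    obtain ⟨j, ⟨h1, h2⟩ | ⟨h1, h2⟩⟩ := hform _ _ hw'
    · have := hx.inj h1
      rw [this, ← h2]
      rwa [← this]
    · have := hx.inj h2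
      have : i = j := by linear_combination this
      rw [this] at hne
      exact absurd h1 hne
  have hone : ∃ i, H.Adj (x i) (x (i + 1)) := by
    obtain ⟨i, ⟨h1, h2⟩ | ⟨h1, h2⟩⟩ := hform u v huv
    · exact ⟨i, h1 ▸ h2 ▸ huv⟩
    · exact ⟨i, h1 ▸ h2 ▸ huv.symm⟩
  obtain ⟨i0, hi0⟩ := hone
  have hall : ∀ k : ℕ, H.Adj (x (i0 + k)) (x (i0 + k + 1)) := by
    intro k
    induction k with
    | zero => simpa using hi0
    | succ k ih =>
      have := hstep _ ih
      push_cast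
      rwa [← add_assoc]
  intro i
  have := hall (i - i0).val
  rw [ZMod.natCast_zmod_val] at this
  simpa using this

end Structure


/-! ### Edge exponents, covers and packings -/

/-- The exponent vector of an edge. -/
def edgeExp {V : Type} (e : Sym2 V) : V →₀ ℕ :=
  Sym2.lift ⟨fun u v => Finsupp.single u 1 + Finsupp.single v 1, fun _ _ => add_comm _ _⟩ e

theorem edgeExp_mk {V : Type} (u v : V) :
    edgeExp s(u, v) = Finsupp.single u 1 + Finsupp.single v 1 := rfl

/-- The exponent vector of a product of edges. -/
def edgeSum {V : Type} {G : SimpleGraph V} (y : Multiset G.edgeSet) : V →₀ ℕ :=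
  (y.map fun e => edgeExp e.1).sum

/-- Exponents of products of `k` edges. -/
def EdgeExps {V : Type} (G : SimpleGraph V) (k : ℕ) : Set (V →₀ ℕ) :=
  {a | ∃ y : Multiset G.edgeSet, y.card = k ∧ edgeSum y = a}

/-- All vertex covers of `H` have weight at least `s`. -/
def Cov {V : Type} (H : SimpleGraph V) (m : V →₀ ℕ) (s : ℕ) : Prop :=
  ∀ W : Finset V, (∀ u v, H.Adj u v → u ∈ W ∨ v ∈ W) → s ≤ ∑ v ∈ W, m v

/-- `m` is divisible by a product of `k` edges. -/
def Pack {V : Type} (G : SimpleGraph V) (k : ℕ) (m : V →₀ ℕ) : Prop :=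
  ∃ a ∈ EdgeExps G k, a ≤ m

section Comb

variable {V : Type} {G : SimpleGraph V}

theorem zero_mem_EdgeExps : (0 : V →₀ ℕ) ∈ EdgeExps G 0 := ⟨0, rfl, rfl⟩

theorem add_mem_EdgeExps {j k : ℕ} {a b : V →₀ ℕ} (ha : a ∈ EdgeExps G j)
    (hb : b ∈ EdgeExps G k) : a + b ∈ EdgeExps G (j + k) := by
  obtain ⟨y, rfl, rfl⟩ := ha
  obtain ⟨z, rfl, rfl⟩ := hb
  exact ⟨y + z, by simp, by simp [edgeSum]⟩

theorem edge_mem_EdgeExps {u v : V} (h : G.Adj u v) :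
    Finsupp.single u 1 + Finsupp.single v 1 ∈ EdgeExps G 1 :=
  ⟨{⟨s(u, v), h⟩}, by simp, by simp [edgeSum, edgeExp_mk]⟩

theorem nsmul_mem_EdgeExps {u v : V} (h : G.Adj u v) (k : ℕ) :
    k • (Finsupp.single u 1 + Finsupp.single v 1) ∈ EdgeExps G k := by
  induction k with
  | zero => simpa using zero_mem_EdgeExps
  | succ k ih =>
    rw [add_smul, one_smul]
    exact add_mem_EdgeExps ih (edge_mem_EdgeExps h)

theorem sum_mem_EdgeExps {ι : Type} (S : Finset ι) (k : ι → ℕ) (a : ι → V →₀ ℕ)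
    (h : ∀ i ∈ S, a i ∈ EdgeExps G (k i)) : ∑ i ∈ S, a i ∈ EdgeExps G (∑ i ∈ S, k i) := by
  classical
  induction S using Finset.induction_on with
  | empty => simpa using zero_mem_EdgeExps
  | insert i S hi ih =>
    rw [Finset.sum_insert hi, Finset.sum_insert hi]
    exact add_mem_EdgeExps (h i (Finset.mem_insert_self _ _))
      (ih fun j hj => h j (Finset.mem_insert_of_mem hj))

theorem EdgeExps_succ {k : ℕ} {a : V →₀ ℕ} (ha : a ∈ EdgeExps G (k + 1)) :
    ∃ b ∈ EdgeExps G k, ∃ u v, G.Adj u v ∧ a = b + (Finsupp.single u 1 + Finsupp.single v 1) := by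
  obtain ⟨y, hy, rfl⟩ := ha
  obtain ⟨e, he⟩ := Multiset.card_pos_iff_exists_mem.1 (by rw [hy]; exact Nat.succ_pos k)
  obtain ⟨z, rfl⟩ := Multiset.exists_cons_of_mem he
  clear he
  obtain ⟨⟨u, v⟩, he⟩ := e
  refine ⟨edgeSum z, ⟨z, by simpa using hy, rfl⟩, u, v, he, ?_⟩
  simp only [edgeSum, Multiset.map_cons, Multiset.sum_cons]
  rw [add_comm]
  rfl

theorem degree_EdgeExps {k : ℕ} {a : V →₀ ℕ} (ha : a ∈ EdgeExps G k) : a.degree = 2 * k := by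
  induction k generalizing a with
  | zero =>
    obtain ⟨y, hy, rfl⟩ := ha
    rw [Multiset.card_eq_zero] at hy
    subst hy
    simp [edgeSum]
  | succ k ih =>
    obtain ⟨b, hb, u, v, -, rfl⟩ := EdgeExps_succ ha
    simp [ih hb]
    ring

theorem Pack.mono {j k : ℕ} {m : V →₀ ℕ} (h : Pack G k m) (hjk : j ≤ k) : Pack G j m := by
  induction k, hjk using Nat.le_induction with
  | base => exact h
  | succ k hk ih =>
    apply ih
    obtain ⟨a, ha, ham⟩ := h
    obtain ⟨b, hb, u, v, -, rfl⟩ := EdgeExps_succ ha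
    exact ⟨b, hb, le_trans le_self_add ham⟩

/-- Leaf reduction. -/
theorem leaf_reduction [Fintype V] (N : ℕ) : ∀ (H : SimpleGraph V) (m : V →₀ ℕ) (s : ℕ),
    H ≤ G → m.degree ≤ N → Cov H m s →
    ∃ t ≤ s, ∃ H' ≤ H, ∃ m' : V →₀ ℕ, ∃ a ∈ EdgeExps G t, m = a + m' ∧ Cov H' m' (s - t) ∧
      (∀ v w, H'.Adj v w → ∃ w', w' ≠ w ∧ H'.Adj v w') ∧
      (∀ v w, H'.Adj v w → m' v ≠ 0) := by
  classical
  induction N with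
  | zero =>
    intro H m s hH hm hc
    have hm0 : m = 0 := (Finsupp.degree_eq_zero_iff m).1 (Nat.le_zero.1 hm)
    refine ⟨0, Nat.zero_le _, ⊥, bot_le, m, 0, zero_mem_EdgeExps, by simp, ?_, by simp, by simp⟩
    intro W hW
    have := hc Finset.univ (by simp)
    simp [hm0] at this
    simp [this]
  | succ N ih =>
    intro H m s hH hm hc
    let H1 : SimpleGraph V :=
      { Adj := fun u v => H.Adj u v ∧ m u ≠ 0 ∧ m v ≠ 0
        symm := ⟨fun u v h => ⟨h.1.symm, h.2.2, h.2.1⟩⟩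
        loopless := ⟨fun u h => H.loopless.irrefl u h.1⟩ }
    have hH1 : H1 ≤ H := fun u v h => h.1
    have hc1 : Cov H1 m s := by
      intro W hW
      have := hc (W ∪ Finset.univ.filter fun v => m v = 0) (by
        intro u v huv
        by_cases hu : m u = 0
        · left; simp [hu]
        · by_cases hv : m v = 0
          · right; simp [hv]
          · rcases hW u v ⟨huv, hu, hv⟩ with h | h
            · left; simp [h]
            · right; simp [h])
      refine this.trans (le_of_eq ?_)
      symm
      apply Finset.sum_subset Finset.subset_union_left
      intro v hv hv'
      simp only [Finset.mem_union, hv', false_or, Finset.mem_filter, Finset.mem_univ, true_and] at hv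
      exact hv
    by_cases hleaf : ∀ v w, H1.Adj v w → ∃ w', w' ≠ w ∧ H1.Adj v w'
    · exact ⟨0, Nat.zero_le _, H1, hH1, m, 0, zero_mem_EdgeExps, by simp, hc1, hleaf,
        fun v w h => h.2.1⟩
    · push Not at hleaf
      obtain ⟨v, w, hvw, huniq⟩ := hleaf
      have huniq : ∀ w', H1.Adj v w' → w' = w := fun w' h => by
        by_contra hne
        exact huniq w' hne h
      rcases s with _ | s
      · exact ⟨0, le_rfl, ⊥, bot_le, m, 0, zero_mem_EdgeExps, by simp, fun W _ => Nat.zero_le _,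
          by simp, by simp⟩
      have hne : v ≠ w := H1.ne_of_adj hvw
      let e : V →₀ ℕ := Finsupp.single v 1 + Finsupp.single w 1
      have hem : e ≤ m := by
        intro u
        have h1 := hvw.2.1
        have h2 := hvw.2.2
        simp only [e, Finsupp.add_apply, Finsupp.single_apply]
        split_ifs with ha hb hb
        · exact absurd (ha.trans hb.symm) hne
        · subst ha; omega
        · subst hb; omega
        · omega
      obtain ⟨m1, rfl⟩ := le_iff_exists_add.1 hem
      have hdeg : m1.degree ≤ N := by
        simp [e] at hm
        omega
      have hc2 : Cov H1 m1 s := by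
        intro W hW
        have hW' : ∀ W' ⊆ W, (∀ a b, H1.Adj a b → a ∈ W' ∨ b ∈ W') → (v ∉ W' ∨ w ∉ W') →
            s ≤ ∑ u ∈ W, m1 u := by
          intro W' hsub hcov hex
          have h1 := hc1 W' hcov
          have h2 : ∑ u ∈ W', e u ≤ 1 := by
            simp only [e, Finsupp.add_apply, Finset.sum_add_distrib, Finsupp.single_apply,
              Finset.sum_ite_eq]
            rcases hex with h | h <;> simp only [h, if_false] <;> split_ifs <;> omega
          have h3 : ∑ u ∈ W', m1 u ≤ ∑ u ∈ W, m1 u := Finset.sum_le_sum_of_subset hsub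
          simp only [Finsupp.add_apply, Finset.sum_add_distrib] at h1
          omega
        by_cases hw : w ∈ W
        · refine hW' (W.erase v) (Finset.erase_subset _ _) ?_ (Or.inl (by simp))
          intro a b hab
          by_cases ha : a = v
          · subst ha
            have := huniq b hab
            subst this
            right; simp [hne.symm, hw]
          · by_cases hb : b = v
            · subst hb
              have := huniq a hab.symm
              subst this
              left; simp [hne.symm, hw]
            · simpa [ha, hb] using hW a b hab
        · exact hW' W subset_rfl hW (Or.inr hw)
      obtain ⟨t, ht, H', hH', m', a, ha, hm', hcov, hd, hpos⟩ :=
        ih H1 m1 s (hH1.trans hH) hdeg hc2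
      refine ⟨t + 1, by omega, H', hH'.trans hH1, m', a + e,
        add_mem_EdgeExps ha (edge_mem_EdgeExps (hH (hH1 hvw))), ?_, ?_, hd, hpos⟩
      · rw [hm']; abel
      · simpa using hcov

variable [Fintype V] {n : ℕ} {x : ZMod (2 * n + 1) → V}

theorem konig_missing (hn : 1 ≤ n) (hx : IsUnicyclicOddCycle G n x) (H : SimpleGraph V)
    (hHG : H ≤ G) (i : ZMod (2 * n + 1)) (hi : ¬ H.Adj (x i) (x (i + 1))) (m : V →₀ ℕ) (s : ℕ)
    (hc : Cov H m s) : Pack G s m := by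
  obtain ⟨t, ht, H', hH', m', a, ha, hm', hcov, hd, hpos⟩ :=
    leaf_reduction m.degree H m s hHG le_rfl hc
  have hcore := core_structure hn hx H' (hH'.trans hHG) hd
  have hno : ¬ ∃ u v, H'.Adj u v := fun h => hi (hH' (hcore.2 h i))
  push Not at hno
  have := hcov ∅ (fun u v h => absurd h (hno u v))
  simp at this
  have hts : t = s := by omega
  subst hts
  exact ⟨a, ha, by rw [hm']; exact le_self_add⟩

end Comb


/-! ### The cycle case -/

section Cycle

/-- weight of a predicate -/
def wt (N : ℕ) (a : ℕ → ℕ) (U : ℕ → Prop) : ℕ :=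
  open Classical in ∑ j ∈ Finset.range N, if U j then a j else 0

theorem wt_add (N : ℕ) (a : ℕ → ℕ) (U U' : ℕ → Prop) (k : ℕ) (hk : k < N)
    (h : ∀ j < N, j ≠ k → (U j ↔ ¬ U' j)) (h1 : U k) (h2 : U' k) :
    wt N a U + wt N a U' = ∑ j ∈ Finset.range N, a j + a k := by
  classical
  have : a k = ∑ j ∈ Finset.range N, if j = k then a j else 0 := by
    rw [Finset.sum_ite_eq' (Finset.range N) k a]
    simp [hk]
  rw [this]
  unfold wt
  rw [← Finset.sum_add_distrib, ← Finset.sum_add_distrib]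
  refine Finset.sum_congr rfl fun j hj => ?_
  by_cases hjk : j = k
  · subst hjk; simp [h1, h2]
  · have := h j (Finset.mem_range.1 hj) hjk
    by_cases hu : U' j <;> simp [this, hu, hjk]

theorem wt_add' (N : ℕ) (a : ℕ → ℕ) (A B U U' : ℕ → Prop) (k : ℕ) (hk : k < N)
    (h : ∀ j < N, j ≠ k → ((U j ↔ A j) ∧ (U' j ↔ B j)) ∨ ((U j ↔ B j) ∧ (U' j ↔ A j)))
    (h1 : U' k) (h2 : ¬ U k) (h3 : ¬ A k) (h4 : ¬ B k) :
    wt N a U + wt N a U' = wt N a A + wt N a B + a k := by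
  classical
  have : a k = ∑ j ∈ Finset.range N, if j = k then a j else 0 := by
    rw [Finset.sum_ite_eq' (Finset.range N) k a]
    simp [hk]
  rw [this]
  unfold wt
  rw [← Finset.sum_add_distrib, ← Finset.sum_add_distrib, ← Finset.sum_add_distrib]
  refine Finset.sum_congr rfl fun j hj => ?_
  by_cases hjk : j = k
  · subst hjk; simp [h1, h2, h3, h4]
  · rcases h j (Finset.mem_range.1 hj) hjk with ⟨h, h'⟩ | ⟨h, h'⟩
    · simp [h, h', hjk]
    · simp [h, h', hjk, add_comm]

theorem seq_core (n s : ℕ) (hn : 1 ≤ n) (a : ℕ → ℕ) (ha0 : a 0 = 1)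
    (hcov : ∀ U : ℕ → Prop, (∀ j < 2 * n, U j ∨ U (j + 1)) → (U (2 * n) ∨ U 0) →
      s ≤ wt (2 * n + 1) a U)
    (A B : ℕ → Prop) (hA : ∀ j < 2 * n, A j ∨ A (j + 1)) (hAw : wt (2 * n + 1) a A < s)
    (hB : ∀ j < 2 * n, 1 ≤ j → B j ∨ B (j + 1)) (hB' : B (2 * n) ∨ B 0)
    (hBw : wt (2 * n + 1) a B < s) :
    ∃ z : ℕ → ℕ, z 0 + 1 = a 1 ∧ (∀ k < 2 * n - 1, z k + z (k + 1) + 1 = a (k + 2)) ∧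
      z (2 * n - 1) = 0 ∧ ∑ j ∈ Finset.range (2 * n - 1), z j + n + 1 = s := by
  classical
  have hA0 : ¬ A 0 := fun h => absurd (hcov A hA (Or.inr h)) (by omega)
  have hA1 : A 1 := (hA 0 (by omega)).resolve_left hA0
  have hBcov : ¬ (B 0 ∨ B 1) := fun h => by
    refine absurd (hcov B ?_ hB') (by omega)
    intro j hj
    rcases Nat.eq_zero_or_pos j with rfl | h'
    · exact h
    · exact hB j hj h'
  push Not at hBcov
  obtain ⟨hB0, hB1⟩ := hBcov
  have hB2n : B (2 * n) := hB'.resolve_right hB0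
  have hopp : ∀ j, 1 ≤ j → j ≤ 2 * n → (A j ↔ ¬ B j) := by
    by_contra hcon
    push Not at hcon
    have hex : ∃ j, 1 ≤ j ∧ j ≤ 2 * n ∧ (A j ↔ B j) := by
      obtain ⟨j, h1, h2, h3⟩ := hcon
      exact ⟨j, h1, h2, by tauto⟩
    obtain ⟨k, ⟨hk1, hk2, hk3⟩, hkmin⟩ :
        ∃ k, (1 ≤ k ∧ k ≤ 2 * n ∧ (A k ↔ B k)) ∧
          ∀ j < k, ¬ (1 ≤ j ∧ j ≤ 2 * n ∧ (A j ↔ B j)) :=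
      ⟨Nat.find hex, Nat.find_spec hex, fun j hj => Nat.find_min hex hj⟩
    have hk : 2 ≤ k := by
      by_contra h
      have : k = 1 := by omega
      subst this
      tauto
    have hAk : A k ∧ B k := by
      obtain ⟨j, rfl⟩ : ∃ j, k = j + 1 := ⟨k - 1, by omega⟩
      have h1 := hkmin j (by omega)
      have h2 := hA j (by omega)
      have h3 := hB j (by omega) (by omega)
      have h4 : ¬ (A j ↔ B j) := fun h => h1 ⟨by omega, by omega, h⟩
      tauto
    have c1 := hcov (fun j => if j ≤ k then A j else B j) (by
      intro j hj
      rcases lt_trichotomy j k with h | h | h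
      · have e1 : j ≤ k := by omega
        have e2 : j + 1 ≤ k := by omega
        simp only [e1, e2, if_true]
        exact hA j hj
      · subst h; left; simp [hAk.1]
      · have e1 : ¬ j ≤ k := by omega
        have e2 : ¬ j + 1 ≤ k := by omega
        simp only [e1, e2, if_false]
        exact hB j hj (by omega)) (by
      left
      by_cases h : 2 * n ≤ k
      · have : k = 2 * n := by omega
        subst this
        simp [hAk.1]
      · simp [h, hB2n])
    have c2 := hcov (fun j => j = 0 ∨ (if j ≤ k then B j else A j)) (by
      intro j hj
      rcases Nat.eq_zero_or_pos j with h0 | h0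
      · left; left; exact h0
      rcases lt_trichotomy j k with h | h | h
      · have e1 : j ≤ k := by omega
        have e2 : j + 1 ≤ k := by omega
        simp only [e1, e2, if_true]
        have := hB j hj h0
        tauto
      · subst h; left; right; simp [hAk.2]
      · have e1 : ¬ j ≤ k := by omega
        have e2 : ¬ j + 1 ≤ k := by omega
        simp only [e1, e2, if_false]
        have := hA j hj
        tauto) (by right; left; rfl)
    have := wt_add' (2 * n + 1) a A B (fun j => if j ≤ k then A j else B j)
      (fun j => j = 0 ∨ (if j ≤ k then B j else A j)) 0 (by omega) (by
        intro j hj hj0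
        by_cases h : j ≤ k <;> simp [h, hj0]) (Or.inl rfl) (by simp [hA0]) hA0 hB0
    omega
  set T := ∑ j ∈ Finset.range (2 * n + 1), a j with hT
  have hT1 : T + 1 ≤ 2 * s := by
    have h2 := wt_add' (2 * n + 1) a A B A (fun j => j = 0 ∨ B j) 0 (by omega) (by
      intro j hj hj0
      left; simp [hj0]) (Or.inl rfl) hA0 hA0 hB0
    have h4 : wt (2 * n + 1) a A + wt (2 * n + 1) a (fun j => j = 0 ∨ B j) = T := by
      rw [hT]
      unfold wt
      rw [← Finset.sum_add_distrib]
      refine Finset.sum_congr rfl fun j hj => ?_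
      have hj := Finset.mem_range.1 hj
      rcases Nat.eq_zero_or_pos j with rfl | h0
      · simp [hA0]
      · have := hopp j h0 (by omega)
        have h0' : j ≠ 0 := by omega
        by_cases hb : B j <;> simp [this, hb, h0']
    omega
  have hE := hcov (fun j => j % 2 = 0) (by intro j hj; omega) (by simp)
  have hO := hcov (fun j => j = 0 ∨ j % 2 = 1) (by intro j hj; omega) (by simp)
  have hEO := wt_add (2 * n + 1) a (fun j => j % 2 = 0) (fun j => j = 0 ∨ j % 2 = 1) 0 (by omega)
    (by intro j hj hj0; omega) (by simp) (by simp)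
  rw [← hT, ha0] at hEO
  let U : ℕ → ℕ → Prop := fun k j => (j ≤ k + 1 ∧ j % 2 = (k + 1) % 2) ∨ (k + 1 < j ∧ j % 2 = k % 2)
  have hU : ∀ k, k ≤ 2 * n - 1 → s ≤ wt (2 * n + 1) a (U k) := by
    intro k hk
    refine hcov _ ?_ ?_
    · intro j hj
      simp only [U]
      omega
    · simp only [U]
      omega
  have hU0 := wt_add (2 * n + 1) a (U 0) (fun j => j = 0 ∨ j % 2 = 1) 1 (by omega)
    (by intro j hj hj0; simp only [U]; omega) (by simp [U]) (by simp)
  have hUk : ∀ k < 2 * n - 1, wt (2 * n + 1) a (U k) + wt (2 * n + 1) a (U (k + 1)) = T + a (k + 2) := by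
    intro k hk
    refine wt_add _ _ _ _ (k + 2) (by omega) ?_ ?_ ?_
    · intro j hj hj0; simp only [U]; omega
    · exact Or.inr ⟨by omega, by omega⟩
    · exact Or.inl ⟨by omega, by omega⟩
  have hUl : wt (2 * n + 1) a (U (2 * n - 1)) = wt (2 * n + 1) a (fun j => j % 2 = 0) := by
    unfold wt
    refine Finset.sum_congr rfl fun j hj => ?_
    have hj := Finset.mem_range.1 hj
    have : U (2 * n - 1) j ↔ j % 2 = 0 := by simp only [U]; omega
    simp [this]
  rw [← hT] at hU0
  have hz0 : wt (2 * n + 1) a (U 0) - s + 1 = a 1 := by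
    have := hU 0 (by omega)
    omega
  have hzk : ∀ k < 2 * n - 1, (wt (2 * n + 1) a (U k) - s) + (wt (2 * n + 1) a (U (k + 1)) - s) + 1
      = a (k + 2) := by
    intro k hk
    have h1 := hU k (by omega)
    have h2 := hU (k + 1) (by omega)
    have h3 := hUk k hk
    omega
  refine ⟨fun k => wt (2 * n + 1) a (U k) - s, hz0, hzk, by simp only; omega, ?_⟩
  generalize hz : (fun k => wt (2 * n + 1) a (U k) - s) = z
  have hz0 : z 0 + 1 = a 1 := by rw [← hz]; exact hz0
  have hzk : ∀ k < 2 * n - 1, z k + z (k + 1) + 1 = a (k + 2) := by rw [← hz]; exact hzk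
  have hzl : z (2 * n - 1) = 0 := by rw [← hz]; simp only; omega
  have hsum : ∀ k ≤ 2 * n - 1, 2 * ∑ j ∈ Finset.range k, z j + z k + (k + 1) =
      ∑ j ∈ Finset.range (k + 1), a (j + 1) := by
    intro k
    induction k with
    | zero => intro _; simpa using hz0
    | succ k ih =>
      intro hk
      have h1 := ih (by omega)
      have h2 := hzk k (by omega)
      rw [Finset.sum_range_succ, Finset.sum_range_succ _ (k + 1), ← h1]
      change _ = _ + a (k + 2)
      omega
  have h1 := hsum (2 * n - 1) le_rfl
  have h2 : T = ∑ j ∈ Finset.range (2 * n), a (j + 1) + a 0 := by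
    rw [hT, Finset.sum_range_succ']
  rw [show 2 * n - 1 + 1 = 2 * n by omega, hzl] at h1
  change ∑ j ∈ Finset.range (2 * n - 1), z j + n + 1 = s
  omega

end Cycle


section CycleGraph

variable {V : Type} [Fintype V] {G : SimpleGraph V} {n : ℕ} {x : ZMod (2 * n + 1) → V}

/-- exponent of the product of the cycle variables -/
def cycExp {V : Type} {n : ℕ} (x : ZMod (2 * n + 1) → V) : V →₀ ℕ :=
  ∑ i, Finsupp.single (x i) 1

theorem natCast_inj_range {n i j : ℕ} (hi : i < 2 * n + 1) (hj : j < 2 * n + 1)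
    (h : (i : ZMod (2 * n + 1)) = j) : i = j := by
  rw [ZMod.natCast_eq_natCast_iff'] at h
  rwa [Nat.mod_eq_of_lt hi, Nat.mod_eq_of_lt hj] at h

theorem sum_zmod_eq_range {M : Type} [AddCommMonoid M] (n : ℕ) (f : ZMod (2 * n + 1) → M) :
    ∑ i, f i = ∑ j ∈ Finset.range (2 * n + 1), f (j : ZMod (2 * n + 1)) := by
  classical
  symm
  refine Finset.sum_bij (fun j _ => (j : ZMod (2 * n + 1))) (fun _ _ => Finset.mem_univ _) ?_ ?_
    (fun _ _ => rfl)
  · intro i hi j hj h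
    exact natCast_inj_range (Finset.mem_range.1 hi) (Finset.mem_range.1 hj) h
  · intro i _
    exact ⟨i.val, Finset.mem_range.2 (ZMod.val_lt i), ZMod.natCast_zmod_val i⟩

theorem cast_two_n (n : ℕ) : ((2 * n : ℕ) : ZMod (2 * n + 1)) + 1 = 0 := by
  have := ZMod.natCast_self (2 * n + 1)
  push_cast at this ⊢
  exact this

theorem cycle_zero_case (hn : 1 ≤ n) (hx : IsUnicyclicOddCycle G n x) (H : SimpleGraph V)
    (hHG : H ≤ G)
    (hform : ∀ u v, H.Adj u v → ∃ i, (u = x i ∧ v = x (i + 1)) ∨ (v = x i ∧ u = x (i + 1)))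
    (hall : ∀ i, H.Adj (x i) (x (i + 1)))
    (m : V →₀ ℕ) (s : ℕ) (hc : Cov H m s) (hpos : ∀ i, m (x i) ≠ 0) (h0 : m (x 0) = 1) :
    Pack G s m ∨ (n + 1 ≤ s ∧ ∃ a ∈ EdgeExps G (s - (n + 1)), a + cycExp x ≤ m) := by
  classical
  by_cases hpack : Pack G s m
  · exact Or.inl hpack
  right
  let a : ℕ → ℕ := fun j => m (x (j : ZMod (2 * n + 1)))
  have hinj : ∀ S ⊆ Finset.range (2 * n + 1),
      Set.InjOn (fun j : ℕ => x (j : ZMod (2 * n + 1))) (S : Set ℕ) := by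
    intro S hS i hi j hj h
    exact natCast_inj_range (Finset.mem_range.1 (hS hi)) (Finset.mem_range.1 (hS hj)) (hx.inj h)
  have hcov : ∀ U : ℕ → Prop, (∀ j < 2 * n, U j ∨ U (j + 1)) → (U (2 * n) ∨ U 0) →
      s ≤ wt (2 * n + 1) a U := by
    intro U h1 h2
    have hstep : ∀ i : ZMod (2 * n + 1),
        x i ∈ ((Finset.range (2 * n + 1)).filter U).image (fun j : ℕ => x (j : ZMod (2 * n + 1))) ∨
        x (i + 1) ∈ ((Finset.range (2 * n + 1)).filter U).image
          (fun j : ℕ => x (j : ZMod (2 * n + 1))) := by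
      intro i
      have hi := ZMod.val_lt i
      have hiv := ZMod.natCast_zmod_val i
      generalize i.val = j at hi hiv
      subst hiv
      simp only [Finset.mem_image, Finset.mem_filter, Finset.mem_range]
      rcases Nat.lt_or_ge j (2 * n) with h | h
      · rcases h1 j h with h | h
        · left; exact ⟨j, ⟨hi, h⟩, rfl⟩
        · right; exact ⟨j + 1, ⟨by omega, h⟩, by push_cast; rfl⟩
      · have : j = 2 * n := by omega
        subst this
        rcases h2 with h | h
        · left; exact ⟨2 * n, ⟨hi, h⟩, rfl⟩
        · right; exact ⟨0, ⟨by omega, h⟩, by rw [cast_two_n]; simp⟩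
    have := hc (((Finset.range (2 * n + 1)).filter U).image
      (fun j : ℕ => x (j : ZMod (2 * n + 1)))) (by
        intro u v huv
        obtain ⟨i, ⟨rfl, rfl⟩ | ⟨rfl, rfl⟩⟩ := hform u v huv
        · exact hstep i
        · exact (hstep i).symm)
    rw [Finset.sum_image (hinj _ (Finset.filter_subset _ _)), Finset.sum_filter] at this
    unfold wt
    convert this
  have hmiss : ∀ i0 : ZMod (2 * n + 1), ∃ U : ℕ → Prop, wt (2 * n + 1) a U < s ∧
      (∀ j < 2 * n, (j : ZMod (2 * n + 1)) ≠ i0 → U j ∨ U (j + 1)) ∧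
      (((2 * n : ℕ) : ZMod (2 * n + 1)) ≠ i0 → U (2 * n) ∨ U 0) := by
    intro i0
    let H' : SimpleGraph V :=
      { Adj := fun u v => H.Adj u v ∧ ¬ (u = x i0 ∧ v = x (i0 + 1)) ∧ ¬ (v = x i0 ∧ u = x (i0 + 1))
        symm := ⟨fun u v h => ⟨h.1.symm, h.2.2, h.2.1⟩⟩
        loopless := ⟨fun u h => H.loopless.irrefl u h.1⟩ }
    have hncov : ¬ Cov H' m s := fun h =>
      hpack (konig_missing hn hx H' (fun u v h => hHG h.1) i0 (fun h => h.2.1 ⟨rfl, rfl⟩) m s h)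
    unfold Cov at hncov
    push Not at hncov
    obtain ⟨W, hW, hWs⟩ := hncov
    have hadj : ∀ i, i ≠ i0 → x i ∈ W ∨ x (i + 1) ∈ W := by
      intro i hi
      refine hW _ _ ⟨hall i, fun h => hi (hx.inj h.1), ?_⟩
      rintro ⟨h1, h2⟩
      have h1 := hx.inj h1
      have h2 := hx.inj h2
      apply zmod_two_ne_zero hn
      rw [h2] at h1
      linear_combination h1
    refine ⟨fun j => x (j : ZMod (2 * n + 1)) ∈ W, ?_, ?_, ?_⟩
    · refine lt_of_le_of_lt ?_ hWs
      have : wt (2 * n + 1) a (fun j => x (j : ZMod (2 * n + 1)) ∈ W) =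
          ∑ v ∈ ((Finset.range (2 * n + 1)).filter fun j : ℕ => x (j : ZMod (2 * n + 1)) ∈ W).image
            (fun j : ℕ => x (j : ZMod (2 * n + 1))), m v := by
        rw [Finset.sum_image (hinj _ (Finset.filter_subset _ _)), Finset.sum_filter]
        unfold wt
        congr!
      rw [this]
      apply Finset.sum_le_sum_of_subset
      intro v hv
      simp only [Finset.mem_image, Finset.mem_filter] at hv
      obtain ⟨j, ⟨_, hj⟩, rfl⟩ := hv
      exact hj
    · intro j _ hj
      have := hadj _ hj
      push_cast
      exact this
    · intro hj
      have := hadj _ hj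
      rw [cast_two_n] at this
      simpa using this
  obtain ⟨A, hAw, hA, hA'⟩ := hmiss ((2 * n : ℕ) : ZMod (2 * n + 1))
  obtain ⟨B, hBw, hB, hB'⟩ := hmiss 0
  have hne0 : ∀ j, j < 2 * n + 1 → 1 ≤ j → (j : ZMod (2 * n + 1)) ≠ 0 := by
    intro j hj hj1 h
    have := natCast_inj_range (j := 0) hj (by omega) (by simpa using h)
    omega
  obtain ⟨z, hz0, hzk, hzl, hzs⟩ := seq_core n s hn a (by simpa [a] using h0) hcov A B
    (fun j hj => hA j hj (fun h => by
      have := natCast_inj_range (by omega) (by omega) h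
      omega)) hAw
    (fun j hj hj1 => hB j hj (hne0 j (by omega) hj1)) (hB' (hne0 _ (by omega) (by omega))) hBw
  refine ⟨by omega, ?_⟩
  let S : ℕ → V →₀ ℕ := fun j => Finsupp.single (x ((j + 1 : ℕ) : ZMod (2 * n + 1))) 1
  refine ⟨∑ j ∈ Finset.range (2 * n - 1), z j • (S j + S (j + 1)), ?_, ?_⟩
  · rw [show s - (n + 1) = ∑ j ∈ Finset.range (2 * n - 1), z j by omega]
    apply sum_mem_EdgeExps
    intro j _
    apply nsmul_mem_EdgeExps
    have := hHG (hall ((j + 1 : ℕ) : ZMod (2 * n + 1)))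
    push_cast at this ⊢
    exact this
  · have htel : ∀ k ≤ 2 * n - 1, ∑ j ∈ Finset.range k, z j • (S j + S (j + 1)) + z k • S k +
        ∑ j ∈ Finset.range (k + 1), S j = ∑ j ∈ Finset.range (k + 1), a (j + 1) • S j := by
      intro k
      induction k with
      | zero =>
        intro _
        simp [← hz0, add_smul]
      | succ k ih =>
        intro hk
        rw [Finset.sum_range_succ _ (k + 1), Finset.sum_range_succ _ (k + 1), ← ih (by omega)]
        change _ = _ + a (k + 2) • S (k + 1)
        rw [← hzk k (by omega), Finset.sum_range_succ _ k]
        simp only [smul_add, add_smul, one_smul]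
        abel
    have h1 := htel (2 * n - 1) le_rfl
    rw [hzl, zero_smul, add_zero, show 2 * n - 1 + 1 = 2 * n by omega] at h1
    have h2 : cycExp x = ∑ j ∈ Finset.range (2 * n), S j + Finsupp.single (x 0) 1 := by
      unfold cycExp
      rw [sum_zmod_eq_range n (fun i => Finsupp.single (x i) 1), Finset.sum_range_succ']
      simp [S]
    have h3 : ∑ j ∈ Finset.range (2 * n), a (j + 1) • S j + Finsupp.single (x 0) 1 =
        ∑ i, Finsupp.single (x i) (m (x i)) := by
      rw [sum_zmod_eq_range n (fun i => Finsupp.single (x i) (m (x i))), Finset.sum_range_succ']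
      simp [S, a, h0]
    rw [h2, ← add_assoc, h1, h3]
    intro v
    rw [Finsupp.finsetSum_apply]
    simp only [Finsupp.single_apply]
    by_cases hv : ∃ i, x i = v
    · obtain ⟨i, rfl⟩ := hv
      rw [Finset.sum_eq_single i]
      · simp
      · intro j _ hj
        rw [if_neg]
        exact fun h => hj (hx.inj h)
      · simp
    · push Not at hv
      simp [hv]

theorem shift_unicyclic (hx : IsUnicyclicOddCycle G n x) (i0 : ZMod (2 * n + 1)) :
    IsUnicyclicOddCycle G n (fun i => x (i + i0)) where
  connected := hx.connected
  edge_count := hx.edge_count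
  inj := fun i j h => by simpa using hx.inj h
  adj_iff := fun i j => by
    rw [hx.adj_iff]
    constructor
    · rintro (h | h)
      · left; linear_combination h
      · right; linear_combination h
    · rintro (h | h)
      · left; linear_combination h
      · right; linear_combination h

theorem cycExp_shift (i0 : ZMod (2 * n + 1)) : cycExp (fun i => x (i + i0)) = cycExp x := by
  unfold cycExp
  exact Equiv.sum_comp (Equiv.addRight i0) (fun i => Finsupp.single (x i) 1)

theorem comb_main (hn : 1 ≤ n) (hx : IsUnicyclicOddCycle G n x) (m : V →₀ ℕ) (s : ℕ)
    (hs : s ≤ 2 * n + 1) (hc : Cov G m s) :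
    Pack G s m ∨ (n + 1 ≤ s ∧ ∃ a ∈ EdgeExps G (s - (n + 1)), a + cycExp x ≤ m) := by
  classical
  obtain ⟨t, ht, H', hH', m', a, ha, hm', hcov, hd, hpos⟩ :=
    leaf_reduction m.degree G m s le_rfl le_rfl hc
  obtain ⟨hform, hcore⟩ := core_structure hn hx H' hH' hd
  have hsub : Pack G (s - t) m' ∨
      (n + 1 ≤ s - t ∧ ∃ a ∈ EdgeExps G (s - t - (n + 1)), a + cycExp x ≤ m') := by
    by_cases hE : ∃ u v, H'.Adj u v
    · have hall := hcore hE
      have hp : ∀ i, m' (x i) ≠ 0 := fun i => hpos _ _ (hall i)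
      by_cases h2 : ∀ i, m' (x i) ≠ 1
      · left
        refine Pack.mono (k := 2 * n + 1) ?_ (by omega)
        refine ⟨∑ i, (Finsupp.single (x i) 1 + Finsupp.single (x (i + 1)) 1), ?_, ?_⟩
        · have := sum_mem_EdgeExps (G := G) (Finset.univ : Finset (ZMod (2 * n + 1))) (fun _ => 1)
            (fun i => (Finsupp.single (x i) 1 + Finsupp.single (x (i + 1)) 1))
            (fun i _ => edge_mem_EdgeExps (hH' (hall i)))
          simpa [ZMod.card] using this
        · rw [Finset.sum_add_distrib]
          have h3 := cycExp_shift (x := x) 1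
          unfold cycExp at h3
          rw [h3]
          intro v
          rw [Finsupp.add_apply, Finsupp.finsetSum_apply]
          simp only [Finsupp.single_apply]
          by_cases hv : ∃ i, x i = v
          · obtain ⟨i, rfl⟩ := hv
            rw [Finset.sum_eq_single i]
            · have h4 := hp i
              have h5 := h2 i
              simp only [if_true]
              omega
            · intro j _ hj
              rw [if_neg]
              exact fun h => hj (hx.inj h)
            · simp
          · push Not at hv
            simp [hv]
      · push Not at h2
        obtain ⟨i0, hi0⟩ := h2
        have := cycle_zero_case hn (shift_unicyclic hx i0) H' hH' (by
          intro u v huv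
          obtain ⟨i, h⟩ := hform u v huv
          refine ⟨i - i0, ?_⟩
          rw [show i - i0 + i0 = i by ring, show i - i0 + 1 + i0 = i + 1 by ring]
          exact h) (by
          intro i
          have := hall (i + i0)
          rwa [show i + i0 + 1 = i + 1 + i0 by ring] at this) m' (s - t) hcov
          (fun i => hp _) (by simpa using hi0)
        rwa [cycExp_shift] at this
    · left
      push Not at hE
      have := hcov ∅ (fun u v h => absurd h (hE u v))
      simp at this
      rw [show s - t = 0 by omega]
      exact ⟨0, zero_mem_EdgeExps, zero_le⟩
  rcases hsub with ⟨b, hb, hbm⟩ | ⟨hns, b, hb, hbm⟩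
  · left
    refine ⟨a + b, ?_, ?_⟩
    · have := add_mem_EdgeExps ha hb
      rwa [show t + (s - t) = s by omega] at this
    · rw [hm']
      gcongr
  · right
    refine ⟨by omega, a + b, ?_, ?_⟩
    · have := add_mem_EdgeExps ha hb
      rwa [show t + (s - t - (n + 1)) = s - (n + 1) by omega] at this
    · rw [hm', add_assoc]
      gcongr

end CycleGraph


/-! ### Independence of the edge vectors -/

section Indep

variable {V : Type} [Fintype V] {G : SimpleGraph V} {n : ℕ} {x : ZMod (2 * n + 1) → V}

theorem edgeSum_injective (hn : 1 ≤ n) (hx : IsUnicyclicOddCycle G n x) :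
    Function.Injective (edgeSum : Multiset G.edgeSet → V →₀ ℕ) := by
  classical
  intro y1 y2 hy
  have hsum : ∀ (y : Multiset G.edgeSet) (v : V),
      edgeSum y v = ∑ e : G.edgeSet, y.count e * edgeExp e.1 v := by
    intro y v
    induction y using Multiset.induction_on with
    | empty => simp [edgeSum]
    | cons e y ih =>
      have : edgeSum (e ::ₘ y) = edgeExp e.1 + edgeSum y := by simp [edgeSum]
      rw [this, Finsupp.add_apply, ih]
      simp only [Multiset.count_cons, add_mul, Finset.sum_add_distrib, ite_mul, one_mul, zero_mul]
      rw [Finset.sum_ite_eq' Finset.univ e]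
      simp [add_comm]
  let z : G.edgeSet → ℤ := fun e => (y1.count e : ℤ) - y2.count e
  have hz : ∀ v, ∑ e : G.edgeSet, z e * (edgeExp e.1 v : ℤ) = 0 := by
    intro v
    have h : edgeSum y1 v = edgeSum y2 v := by rw [hy]
    rw [hsum, hsum] at h
    simp only [z, sub_mul, Finset.sum_sub_distrib]
    have : (∑ e : G.edgeSet, (y1.count e : ℤ) * (edgeExp e.1 v : ℤ)) =
        ∑ e : G.edgeSet, (y2.count e : ℤ) * (edgeExp e.1 v : ℤ) := by exact_mod_cast h
    rw [this, sub_self]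
  let H : SimpleGraph V :=
    { Adj := fun u v => ∃ h : G.Adj u v, z ⟨s(u, v), h⟩ ≠ 0
      symm := ⟨fun u v h => by
        obtain ⟨h, hh⟩ := h
        refine ⟨h.symm, ?_⟩
        have : (⟨s(v, u), h.symm⟩ : G.edgeSet) = ⟨s(u, v), h⟩ := Subtype.ext Sym2.eq_swap
        rw [this]
        exact hh⟩
      loopless := ⟨fun u h => G.loopless.irrefl u h.1⟩ }
  have hHG : H ≤ G := fun u v h => h.1
  have hmk : ∀ e : G.edgeSet, z e ≠ 0 → ∀ v, edgeExp e.1 v ≠ 0 →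
      ∃ w, H.Adj v w ∧ e.1 = s(v, w) := by
    rintro ⟨⟨a, b⟩, hab⟩ hze v hv
    change edgeExp s(a, b) v ≠ 0 at hv
    rw [edgeExp_mk] at hv
    simp only [Finsupp.add_apply, Finsupp.single_apply] at hv
    by_cases h1 : a = v
    · subst h1
      exact ⟨b, ⟨hab, hze⟩, rfl⟩
    · by_cases h2 : b = v
      · subst h2
        exact ⟨a, SimpleGraph.Adj.symm (G := H) ⟨hab, hze⟩, Sym2.eq_swap⟩
      · simp [h1, h2] at hv
  have hval : ∀ u v : V, u ≠ v → edgeExp s(u, v) u = 1 := by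
    intro u v h
    simp [edgeExp_mk, h.symm]
  have hdeg : ∀ v w, H.Adj v w → ∃ w', w' ≠ w ∧ H.Adj v w' := by
    intro v w hvw
    by_contra hcon
    push Not at hcon
    obtain ⟨hG, hzz⟩ := id hvw
    have h := hz v
    rw [Finset.sum_eq_single (⟨s(v, w), hG⟩ : G.edgeSet)] at h
    · rw [hval v w hG.ne] at h
      simp at h
      exact hzz h
    · intro e _ hne
      by_contra hprod
      have h1 : z e ≠ 0 := fun h => hprod (by rw [h, zero_mul])
      have h2 : edgeExp e.1 v ≠ 0 := fun h => hprod (by rw [h]; simp)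
      obtain ⟨w', hw', he⟩ := hmk e h1 v h2
      have : w' = w := by
        by_contra h
        exact hcon w' h hw'
      subst this
      exact hne (Subtype.ext he)
    · simp
  obtain ⟨hform, hcore⟩ := core_structure hn hx H hHG hdeg
  have hnone : ¬ ∃ u v, H.Adj u v := by
    intro hE
    have hall := hcore hE
    let c : ZMod (2 * n + 1) → ℤ := fun i => z ⟨s(x i, x (i + 1)), hHG (hall i)⟩
    have hc : ∀ i, c i + c (i + 1) = 0 := by
      intro i
      have h := hz (x (i + 1))
      have hne : (⟨s(x i, x (i + 1)), hHG (hall i)⟩ : G.edgeSet) ≠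
          ⟨s(x (i + 1), x (i + 1 + 1)), hHG (hall (i + 1))⟩ := by
        intro h
        rcases Sym2.eq_iff.1 (Subtype.ext_iff.1 h) with ⟨h1, -⟩ | ⟨h1, -⟩
        · exact (hHG (hall i)).ne h1
        · have := hx.inj h1
          apply zmod_two_ne_zero hn
          linear_combination -this
      rw [Finset.sum_eq_add _ _ hne] at h
      · simp only at h
        have hv' : edgeExp s(x i, x (i + 1)) (x (i + 1)) = 1 := by
          rw [Sym2.eq_swap]
          exact hval _ _ (hHG (hall i)).ne.symm
        rw [hval _ _ (hHG (hall (i + 1))).ne, hv'] at h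
        simpa [c] using h
      · rintro e - ⟨hne1, hne2⟩
        by_contra hprod
        have h1 : z e ≠ 0 := fun h => hprod (by rw [h, zero_mul])
        have h2 : edgeExp e.1 (x (i + 1)) ≠ 0 := fun h => hprod (by rw [h]; simp)
        obtain ⟨w', hw', he⟩ := hmk e h1 _ h2
        obtain ⟨j, ⟨h3, h4⟩ | ⟨h3, h4⟩⟩ := hform _ _ hw'
        · have := hx.inj h3
          subst this
          exact hne2 (Subtype.ext (by rw [he, h4]))
        · have : i = j := by linear_combination hx.inj h4
          subst this
          exact hne1 (Subtype.ext (by rw [he, h3, Sym2.eq_swap]))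
      · simp
      · simp
    have hpow : ∀ k : ℕ, c (k : ZMod (2 * n + 1)) = (-1) ^ k * c 0 := by
      intro k
      induction k with
      | zero => simp
      | succ k ih =>
        have := hc k
        push_cast
        rw [pow_succ]
        linear_combination this - ih
    have h1 := hpow (2 * n + 1)
    rw [ZMod.natCast_self] at h1
    have h2 : (-1 : ℤ) ^ (2 * n + 1) = -1 := by
      rw [pow_succ, pow_mul]; simp
    rw [h2] at h1
    have h3 : c 0 = 0 := by linarith
    exact (hall 0).2 h3
  ext e
  by_contra hne
  apply hnone
  obtain ⟨⟨a, b⟩, hab⟩ := e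
  refine ⟨a, b, hab, ?_⟩
  change (y1.count ⟨Quot.mk _ (a, b), hab⟩ : ℤ) - y2.count ⟨Quot.mk _ (a, b), hab⟩ ≠ 0
  intro h
  apply hne
  have := sub_eq_zero.1 h
  exact_mod_cast this

end Indep


/-! ### Algebra -/

section Alg

variable {V : Type} {𝕜 : Type} [Field 𝕜] {G : SimpleGraph V}

/-- The ideal spanned by a set of monomials. -/
def monIdeal (𝕜 : Type) [Field 𝕜] {V : Type} (S : Set (V →₀ ℕ)) : Ideal (MvPolynomial V 𝕜) :=
  Ideal.span ((fun a => monomial a (1 : 𝕜)) '' S)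

theorem mem_monIdeal {S : Set (V →₀ ℕ)} {f : MvPolynomial V 𝕜} :
    f ∈ monIdeal 𝕜 S ↔ ∀ a ∈ f.support, ∃ b ∈ S, b ≤ a :=
  mem_ideal_span_monomial_image

theorem edgeIdeal_pow (k : ℕ) : (edgeIdeal 𝕜 G) ^ k = monIdeal 𝕜 (EdgeExps G k) := by
  induction k with
  | zero =>
    rw [pow_zero, Ideal.one_eq_top]
    symm
    rw [Ideal.eq_top_iff_one]
    exact Ideal.subset_span ⟨0, zero_mem_EdgeExps, rfl⟩
  | succ k ih =>
    rw [pow_succ, ih, monIdeal, edgeIdeal, Ideal.span_mul_span', monIdeal]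
    congr 1
    ext f
    constructor
    · rintro ⟨_, ⟨a, ha, rfl⟩, _, ⟨u, v, huv, rfl⟩, rfl⟩
      refine ⟨_, add_mem_EdgeExps ha (edge_mem_EdgeExps huv), ?_⟩
      simp [X, monomial_mul]
    · rintro ⟨a, ha, rfl⟩
      obtain ⟨b, hb, u, v, huv, rfl⟩ := EdgeExps_succ ha
      refine ⟨_, ⟨b, hb, rfl⟩, _, ⟨u, v, huv, rfl⟩, ?_⟩
      simp [X, monomial_mul]

theorem mem_edgeIdeal_pow {k : ℕ} {f : MvPolynomial V 𝕜} :
    f ∈ (edgeIdeal 𝕜 G) ^ k ↔ ∀ a ∈ f.support, Pack G k a := by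
  rw [edgeIdeal_pow, mem_monIdeal]
  rfl

variable [Fintype V]

/-- Grading by `W`-degree. -/
def phi (𝕜 : Type) [Field 𝕜] {V : Type} (W : Finset V) :
    MvPolynomial V 𝕜 →ₐ[𝕜] Polynomial (MvPolynomial V 𝕜) :=
  open Classical in
  aeval (fun v => Polynomial.X ^ (if v ∈ W then 1 else 0) * Polynomial.C (X v))

theorem phi_monomial (W : Finset V) (a : V →₀ ℕ) (c : 𝕜) :
    phi 𝕜 W (monomial a c) = Polynomial.monomial (∑ v ∈ W, a v) (monomial a c) := by
  classical
  unfold phi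
  rw [aeval_monomial, Finsupp.prod_fintype _ _ (by simp)]
  simp only [mul_pow, Finset.prod_mul_distrib, ← pow_mul]
  rw [Finset.prod_pow_eq_pow_sum]
  have h1 : ∑ v, (if v ∈ W then 1 else 0) * a v = ∑ v ∈ W, a v := by
    simp [Finset.sum_ite_mem]
  have h2 : (∏ v, Polynomial.C (X v : MvPolynomial V 𝕜) ^ a v) =
      Polynomial.C (monomial a (1 : 𝕜)) := by
    rw [monomial_eq, Finsupp.prod_fintype _ _ (by simp)]
    simp
  have h3 : (monomial a c : MvPolynomial V 𝕜) = C c * monomial a 1 := by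
    rw [C_mul_monomial, mul_one]
  convert_to algebraMap 𝕜 (Polynomial (MvPolynomial V 𝕜)) c *
    (Polynomial.X ^ (∑ v ∈ W, a v) * Polynomial.C (monomial a (1 : 𝕜))) = _
  · rw [← h1, ← h2]
  · rw [← Polynomial.C_mul_X_pow_eq_monomial, h3, Polynomial.C_mul]
    have : algebraMap 𝕜 (Polynomial (MvPolynomial V 𝕜)) c = Polynomial.C (C c) := rfl
    rw [this]
    ring

theorem coeff_phi (W : Finset V) (f : MvPolynomial V 𝕜) (j : ℕ) (a : V →₀ ℕ) :
    coeff a ((phi 𝕜 W f).coeff j) = if ∑ v ∈ W, a v = j then coeff a f else 0 := by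
  classical
  induction f using MvPolynomial.induction_on' with
  | monomial b c =>
    rw [phi_monomial, Polynomial.coeff_monomial]
    by_cases hba : b = a
    · subst hba
      split_ifs <;> simp
    · split_ifs <;> simp [coeff_monomial, hba]
  | add f g hf hg =>
    rw [map_add, Polynomial.coeff_add, coeff_add, hf, hg, coeff_add]
    split_ifs <;> simp

theorem X_pow_dvd_phi (W : Finset V) (f : MvPolynomial V 𝕜) (s : ℕ) :
    Polynomial.X ^ s ∣ phi 𝕜 W f ↔ ∀ a ∈ f.support, s ≤ ∑ v ∈ W, a v := by
  rw [Polynomial.X_pow_dvd_iff]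
  constructor
  · intro h a ha
    by_contra hlt
    have := h _ (not_le.1 hlt)
    have h2 := coeff_phi W f (∑ v ∈ W, a v) a
    rw [this] at h2
    simp at h2
    exact (mem_support_iff.1 ha) h2.symm
  · intro h d hd
    ext a
    rw [coeff_phi, coeff_zero]
    split_ifs with h1
    · by_contra hne
      have := h a (mem_support_iff.2 hne)
      omega
    · rfl

/-- vertex covers -/
def IsCov (G : SimpleGraph V) (W : Finset V) : Prop := ∀ u v, G.Adj u v → u ∈ W ∨ v ∈ W

theorem sum_cov_ge {W : Finset V} (hW : IsCov G W) {k : ℕ} {a : V →₀ ℕ} (ha : Pack G k a) :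
    k ≤ ∑ v ∈ W, a v := by
  classical
  obtain ⟨b, hb, hba⟩ := ha
  refine le_trans ?_ (Finset.sum_le_sum fun v _ => hba v)
  clear hba
  induction k generalizing b with
  | zero => exact Nat.zero_le _
  | succ k ih =>
    obtain ⟨d, hd, u, v, huv, rfl⟩ := EdgeExps_succ hb
    have := ih d hd
    simp only [Finsupp.add_apply, Finset.sum_add_distrib, Finsupp.single_apply,
      Finset.sum_ite_eq]
    rcases hW u v huv with h | h <;> simp only [h, if_true] <;> omega

theorem dvd_of_mem_pow {W : Finset V} (hW : IsCov G W) {k : ℕ} {f : MvPolynomial V 𝕜}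
    (hf : f ∈ (edgeIdeal 𝕜 G) ^ k) : Polynomial.X ^ k ∣ phi 𝕜 W f := by
  rw [X_pow_dvd_phi]
  intro a ha
  exact sum_cov_ge hW (mem_edgeIdeal_pow.1 hf a ha)

theorem mem_of_dvd {f : MvPolynomial V 𝕜}
    (h : ∀ W, IsCov G W → Polynomial.X ∣ phi 𝕜 W f) : f ∈ edgeIdeal 𝕜 G := by
  classical
  rw [← pow_one (edgeIdeal 𝕜 G), mem_edgeIdeal_pow]
  intro a ha
  by_contra hcon
  have hcov : IsCov G (Finset.univ.filter fun v => a v = 0) := by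
    intro u v huv
    by_contra hno
    simp only [Finset.mem_filter, Finset.mem_univ, true_and, not_or] at hno
    apply hcon
    refine ⟨_, edge_mem_EdgeExps huv, ?_⟩
    intro w
    have hne := huv.ne
    simp only [Finsupp.add_apply, Finsupp.single_apply]
    split_ifs with h1 h2 h2
    · exact absurd (h1.trans h2.symm) hne
    · subst h1; omega
    · subst h2; omega
    · omega
  have h1 := h _ hcov
  rw [← pow_one Polynomial.X, X_pow_dvd_phi] at h1
  have h2 := h1 a ha
  have : ∑ v ∈ Finset.univ.filter (fun v => a v = 0), a v = 0 := by
    apply Finset.sum_eq_zero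
    intro v hv
    simpa using hv
  omega

theorem edgeIdeal_radical {f : MvPolynomial V 𝕜} (h : f * f ∈ edgeIdeal 𝕜 G) :
    f ∈ edgeIdeal 𝕜 G := by
  apply mem_of_dvd
  intro W hW
  rw [← pow_one (edgeIdeal 𝕜 G)] at h
  have := dvd_of_mem_pow hW h
  rw [pow_one, map_mul] at this
  exact (Polynomial.prime_X.dvd_or_dvd this).elim id id

theorem mem_localizationComap {R : Type} [CommRing R] (p : Ideal R) (hp : p.IsPrime) (J : Ideal R)
    (r : R) : r ∈ localizationComap p hp J ↔ ∃ u, u ∉ p ∧ u * r ∈ J := by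
  letI := hp
  unfold localizationComap
  rw [Ideal.mem_comap, IsLocalization.algebraMap_mem_map_algebraMap_iff p.primeCompl]
  rfl

open scoped Pointwise in
/-- Minimal covers give associated primes. -/
theorem mem_symbolic_cov {s : ℕ} {f : MvPolynomial V 𝕜} (hf : f ∈ symbolicPower (edgeIdeal 𝕜 G) s)
    (W : Finset V) (hW : IsCov G W) (hmin : ∀ w ∈ W, ∃ v, v ∉ W ∧ G.Adj w v) :
    Polynomial.X ^ s ∣ phi 𝕜 W f := by
  classical
  let P : Ideal (MvPolynomial V 𝕜) :=
    (Ideal.span {(Polynomial.X : Polynomial (MvPolynomial V 𝕜))}).comap (phi 𝕜 W)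
  have hPp : P.IsPrime := by
    have : (Ideal.span {(Polynomial.X : Polynomial (MvPolynomial V 𝕜))}).IsPrime :=
      (Ideal.span_singleton_prime Polynomial.X_ne_zero).2 Polynomial.prime_X
    exact Ideal.comap_isPrime _ _
  have hmem : ∀ g, g ∈ P ↔ Polynomial.X ∣ phi 𝕜 W g := by
    intro g
    simp only [P, Ideal.mem_comap, Ideal.mem_span_singleton]
  let a0 : V →₀ ℕ := Finsupp.equivFunOnFinite.symm fun v => if v ∈ W then 0 else 1
  have ha0 : ∀ v, a0 v = if v ∈ W then 0 else 1 := fun v => rfl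
  let g0 : MvPolynomial V 𝕜 := monomial a0 1
  have hg0 : g0 ∉ P := by
    rw [hmem, ← pow_one Polynomial.X, X_pow_dvd_phi]
    intro h
    have := h a0 (by simp [g0])
    have h2 : ∑ v ∈ W, a0 v = 0 := Finset.sum_eq_zero fun v hv => by simp [ha0, hv]
    omega
  have hass : P ∈ associatedPrimes (MvPolynomial V 𝕜) (MvPolynomial V 𝕜 ⧸ edgeIdeal 𝕜 G) := by
    rw [AssociatedPrimes.mem_iff, isAssociatedPrime_iff]
    refine ⟨hPp, Ideal.Quotient.mk _ g0, ?_⟩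
    ext g
    rw [Submodule.mem_colon_singleton, Submodule.mem_bot]
    have : g • (Ideal.Quotient.mk (edgeIdeal 𝕜 G) g0) = Ideal.Quotient.mk (edgeIdeal 𝕜 G) (g * g0) :=
      rfl
    rw [this, Ideal.Quotient.eq_zero_iff_mem]
    constructor
    · intro hg
      rw [hmem, ← pow_one Polynomial.X, X_pow_dvd_phi] at hg
      rw [← pow_one (edgeIdeal 𝕜 G), mem_edgeIdeal_pow]
      intro a ha
      have hsup : a ∈ g.support + g0.support := support_mul _ _ ha
      obtain ⟨b, hb, d, hd, rfl⟩ := Finset.mem_add.1 hsup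
      have hd : d = a0 := by
        have h : a0 = d := by simpa [g0] using hd
        exact h.symm
      subst hd
      have h1 := hg b hb
      obtain ⟨w, hw, hbw⟩ : ∃ w ∈ W, b w ≠ 0 := by
        by_contra hno
        push Not at hno
        rw [Finset.sum_eq_zero hno] at h1
        omega
      obtain ⟨v, hv, hadj⟩ := hmin w hw
      refine ⟨_, edge_mem_EdgeExps hadj, ?_⟩
      apply add_le_add
      · intro u
        simp only [Finsupp.single_apply]
        split_ifs with h
        · subst h; omega
        · omega
      · intro u
        simp only [Finsupp.single_apply]
        split_ifs with h
        · subst h; simp [ha0, hv]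
        · omega
    · intro hg
      rw [← pow_one (edgeIdeal 𝕜 G)] at hg
      have := dvd_of_mem_pow hW hg
      rw [pow_one, ← hmem] at this
      exact (hPp.mem_or_mem this).resolve_right hg0
  have hfP : f ∈ localizationComap P hPp (edgeIdeal 𝕜 G ^ s) := by
    unfold symbolicPower at hf
    exact Ideal.mem_sInf.1 hf ⟨P, hPp, hass, rfl⟩
  rw [mem_localizationComap] at hfP
  obtain ⟨u, hu, huf⟩ := hfP
  have h1 := dvd_of_mem_pow hW huf
  rw [map_mul] at h1
  rw [hmem] at hu
  exact Polynomial.prime_X.pow_dvd_of_dvd_mul_left s hu h1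

theorem cov_of_mem_symbolic {s : ℕ} {f : MvPolynomial V 𝕜}
    (hf : f ∈ symbolicPower (edgeIdeal 𝕜 G) s) : ∀ a ∈ f.support, Cov G a s := by
  classical
  intro a ha W
  induction W using Finset.strongInduction with
  | H W ih =>
    intro hW
    by_cases hmin : ∀ w ∈ W, ∃ v, v ∉ W ∧ G.Adj w v
    · exact (X_pow_dvd_phi W f s).1 (mem_symbolic_cov hf W hW hmin) a ha
    · push Not at hmin
      obtain ⟨w, hw, hwv⟩ := hmin
      refine (ih (W.erase w) (Finset.erase_ssubset hw) ?_).trans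
        (Finset.sum_le_sum_of_subset (Finset.erase_subset _ _))
      intro u v huv
      by_cases hu : u = w
      · subst hu
        have hv : v ∈ W := by
          by_contra h
          exact hwv v h huv
        right
        simp [huv.ne.symm, hv]
      · by_cases hv : v = w
        · subst hv
          have hv : u ∈ W := by
            by_contra h
            exact hwv u h huv.symm
          left
          simp [hu, hv]
        · simpa [hu, hv] using hW u v huv

variable {n : ℕ} {x : ZMod (2 * n + 1) → V}

theorem cyc_mem_localization (hx : IsUnicyclicOddCycle G n x) (p : Ideal (MvPolynomial V 𝕜))
    (hp : p.IsPrime)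
    (hass : p ∈ associatedPrimes (MvPolynomial V 𝕜) (MvPolynomial V 𝕜 ⧸ edgeIdeal 𝕜 G)) :
    ∃ u, u ∉ p ∧ u * monomial (cycExp x) (1 : 𝕜) ∈ edgeIdeal 𝕜 G ^ (n + 1) := by
  classical
  rw [AssociatedPrimes.mem_iff, isAssociatedPrime_iff] at hass
  obtain ⟨-, fbar, hfbar⟩ := hass
  obtain ⟨f, rfl⟩ := Ideal.Quotient.mk_surjective fbar
  have hmem : ∀ g, g ∈ p ↔ g * f ∈ edgeIdeal 𝕜 G := by
    intro g
    rw [hfbar, Submodule.mem_colon_singleton, Submodule.mem_bot]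
    have : g • (Ideal.Quotient.mk (edgeIdeal 𝕜 G) f) = Ideal.Quotient.mk (edgeIdeal 𝕜 G) (g * f) :=
      rfl
    rw [this, Ideal.Quotient.eq_zero_iff_mem]
  have hfp : f ∉ p := by
    intro h
    have h1 := edgeIdeal_radical ((hmem f).1 h)
    apply hp.ne_top
    rw [Ideal.eq_top_iff_one, hmem, one_mul]
    exact h1
  let U : Finset (ZMod (2 * n + 1)) := Finset.univ.filter fun i => (X (x i) : MvPolynomial V 𝕜) ∈ p
  have hU : ∀ i, i ∈ U ∨ i + 1 ∈ U := by
    intro i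
    simp only [U, Finset.mem_filter, Finset.mem_univ, true_and]
    apply hp.mem_or_mem
    rw [hmem]
    apply Ideal.mul_mem_right
    exact Ideal.subset_span ⟨_, _, (hx.adj_iff i (i + 1)).2 (Or.inl rfl), rfl⟩
  have hcard : n + 1 ≤ U.card := by
    have h1 : (Finset.univ : Finset (ZMod (2 * n + 1))) ⊆ U ∪ U.image (fun i => i - 1) := by
      intro i _
      rcases hU i with h | h
      · simp [h]
      · apply Finset.mem_union_right
        exact Finset.mem_image.2 ⟨i + 1, h, by ring⟩
    have h2 := Finset.card_le_card h1
    have h3 := Finset.card_union_le U (U.image (fun i => i - 1))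
    have h4 : (U.image (fun i => i - 1)).card ≤ U.card := Finset.card_image_le
    rw [Finset.card_univ, ZMod.card] at h2
    omega
  refine ⟨f ^ U.card, fun h => hfp (hp.mem_of_pow_mem _ h), ?_⟩
  have hprod : monomial (cycExp x) (1 : 𝕜) = ∏ i, X (x i) := by
    unfold cycExp
    rw [monomial_sum_one]
    rfl
  rw [hprod, ← Finset.prod_mul_prod_compl U, ← mul_assoc, ← Finset.prod_const,
    ← Finset.prod_mul_distrib]
  apply Ideal.mul_mem_right
  apply Ideal.pow_le_pow_right hcard
  rw [← Finset.prod_const]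
  apply Ideal.prod_mem_prod
  intro i hi
  simp only [U, Finset.mem_filter, Finset.mem_univ, true_and] at hi
  rw [mul_comm]
  exact (hmem _).1 hi

theorem symbolic_eq (hn : 1 ≤ n) (hx : IsUnicyclicOddCycle G n x) (s : ℕ) (hs1 : n + 1 ≤ s)
    (hs2 : s ≤ 2 * n + 1) :
    symbolicPower (edgeIdeal 𝕜 G) s = monIdeal 𝕜 (EdgeExps G s ∪
      (fun a => a + cycExp x) '' EdgeExps G (s - (n + 1))) := by
  apply le_antisymm
  · intro f hf
    rw [mem_monIdeal]
    intro a ha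
    rcases comb_main hn hx a s hs2 (cov_of_mem_symbolic hf a ha) with ⟨b, hb, hba⟩ | ⟨-, b, hb, hba⟩
    · exact ⟨b, Or.inl hb, hba⟩
    · exact ⟨_, Or.inr ⟨b, hb, rfl⟩, hba⟩
  · unfold monIdeal
    rw [Ideal.span_le]
    rintro _ ⟨a, ha, rfl⟩
    unfold symbolicPower
    rw [SetLike.mem_coe, Ideal.mem_sInf]
    rintro _ ⟨p, hp, hass, rfl⟩
    rw [mem_localizationComap]
    rcases ha with ha | ⟨b, hb, rfl⟩
    · refine ⟨1, fun h => hp.ne_top ((Ideal.eq_top_iff_one _).2 h), ?_⟩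
      rw [one_mul, edgeIdeal_pow]
      exact Ideal.subset_span ⟨a, ha, rfl⟩
    · obtain ⟨u, hu, huc⟩ := cyc_mem_localization hx p hp hass
      refine ⟨u, hu, ?_⟩
      have h1 : (monomial b (1 : 𝕜)) ∈ edgeIdeal 𝕜 G ^ (s - (n + 1)) := by
        rw [edgeIdeal_pow]
        exact Ideal.subset_span ⟨b, hb, rfl⟩
      have h2 := Ideal.mul_mem_mul huc h1
      rw [← pow_add, show n + 1 + (s - (n + 1)) = s by omega] at h2
      convert h2 using 1
      rw [mul_assoc, monomial_mul, one_mul, add_comm]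

theorem degree_cycExp : (cycExp x).degree = 2 * n + 1 := by
  unfold cycExp
  rw [map_sum]
  simp [ZMod.card]

end Alg

section Defect

variable {V : Type} [Fintype V] {𝕜 : Type} [Field 𝕜] {G : SimpleGraph V}
variable {n : ℕ} {x : ZMod (2 * n + 1) → V}

theorem degree_le_of_le {a b : V →₀ ℕ} (h : a ≤ b) : a.degree ≤ b.degree := by
  obtain ⟨c, rfl⟩ := exists_add_of_le h
  rw [map_add]
  omega

/-- exponents of the extra generators -/
def genExp (x : ZMod (2 * n + 1) → V) {k : ℕ} (y : Sym G.edgeSet k) : V →₀ ℕ :=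
  edgeSum y.1 + cycExp x

theorem genExp_injective (hn : 1 ≤ n) (hx : IsUnicyclicOddCycle G n x) (k : ℕ) :
    Function.Injective (genExp x : Sym G.edgeSet k → V →₀ ℕ) := by
  intro y1 y2 h
  exact Subtype.ext (edgeSum_injective hn hx (add_right_cancel h))

theorem degree_genExp {k : ℕ} (y : Sym G.edgeSet k) :
    (genExp x y).degree = 2 * k + (2 * n + 1) := by
  unfold genExp
  rw [map_add, degree_cycExp, degree_EdgeExps ⟨y.1, y.2, rfl⟩]

theorem range_genExp (k : ℕ) :
    Set.range (genExp x : Sym G.edgeSet k → V →₀ ℕ) =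
      (fun a => a + cycExp x) '' EdgeExps G k := by
  ext a
  constructor
  · rintro ⟨y, rfl⟩
    exact ⟨_, ⟨y.1, y.2, rfl⟩, rfl⟩
  · rintro ⟨_, ⟨y, hy, rfl⟩, rfl⟩
    exact ⟨⟨y, hy⟩, rfl⟩

/-- coefficients at the extra generators -/
def coeffMap (𝕜 : Type) [Field 𝕜] (G : SimpleGraph V) (x : ZMod (2 * n + 1) → V) (k : ℕ) :
    MvPolynomial V 𝕜 →ₗ[𝕜] (Sym G.edgeSet k → 𝕜) where
  toFun f y := coeff (genExp x y) f
  map_add' f g := by ext y; simp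
  map_smul' c f := by ext y; simp

theorem coeffMap_apply (k : ℕ) (f : MvPolynomial V 𝕜) (y : Sym G.edgeSet k) :
    coeffMap 𝕜 G x k f y = coeff (genExp x y) f := rfl

theorem coeffMap_mul (k : ℕ) (r g : MvPolynomial V 𝕜)
    (hg : ∀ a ∈ g.support, 2 * k + (2 * n + 1) ≤ a.degree) :
    coeffMap 𝕜 G x k (r * g) = constantCoeff r • coeffMap 𝕜 G x k g := by
  classical
  ext y
  rw [coeffMap_apply, coeff_mul, Pi.smul_apply, coeffMap_apply, smul_eq_mul]
  rw [Finset.sum_eq_single (0, genExp x y)]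
  · rfl
  · rintro ⟨a, b⟩ hab hne
    rw [Finset.HasAntidiagonal.mem_antidiagonal] at hab
    dsimp only at hab ⊢
    by_cases hb : coeff b g = 0
    · rw [hb, mul_zero]
    · exfalso
      have h1 := hg b (mem_support_iff.2 hb)
      have h2 := degree_genExp (x := x) y
      rw [← hab, map_add] at h2
      have h3 : a.degree = 0 := by omega
      rw [Finsupp.degree_eq_zero_iff] at h3
      subst h3
      rw [zero_add] at hab
      exact hne (by rw [hab])
  · intro h
    exact absurd (Finset.HasAntidiagonal.mem_antidiagonal.2 (zero_add _)) h

theorem sdefect_eq_card (hn : 1 ≤ n) (hx : IsUnicyclicOddCycle G n x) (s : ℕ) (hs1 : n + 1 ≤ s)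
    (hs2 : s ≤ 2 * n + 1) [Fintype (Sym G.edgeSet (s - (n + 1)))] :
    sdefect (edgeIdeal 𝕜 G) s = Fintype.card (Sym G.edgeSet (s - (n + 1))) := by
  classical
  obtain ⟨k, rfl⟩ := Nat.exists_eq_add_of_le hs1
  have hk : n + 1 + k - (n + 1) = k := by omega
  have hJ := symbolic_eq (𝕜 := 𝕜) hn hx (n + 1 + k) hs1 hs2
  revert hJ
  rename_i inst
  revert inst
  rw [hk]
  intro inst hJ
  have hI := edgeIdeal_pow (𝕜 := 𝕜) (G := G) (n + 1 + k)
  have hdegJ : ∀ f ∈ symbolicPower (edgeIdeal 𝕜 G) (n + 1 + k), ∀ a ∈ f.support,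
      2 * k + (2 * n + 1) ≤ a.degree := by
    intro f hf a ha
    rw [hJ, mem_monIdeal] at hf
    obtain ⟨b, hb, hba⟩ := hf a ha
    refine le_trans ?_ (degree_le_of_le hba)
    rcases hb with hb | hb
    · rw [degree_EdgeExps hb]; omega
    · rw [← range_genExp] at hb
      obtain ⟨y, rfl⟩ := hb
      rw [degree_genExp]
  have hmem : Fintype.card (Sym G.edgeSet k) ∈ {m : ℕ | ∃ S : Finset (MvPolynomial V 𝕜),
      S.card = m ∧ (↑S : Set (MvPolynomial V 𝕜)) ⊆
        (symbolicPower (edgeIdeal 𝕜 G) (n + 1 + k) : Set (MvPolynomial V 𝕜)) ∧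
      edgeIdeal 𝕜 G ^ (n + 1 + k) ⊔ Ideal.span (↑S : Set (MvPolynomial V 𝕜)) =
        symbolicPower (edgeIdeal 𝕜 G) (n + 1 + k)} := by
    let F : Sym G.edgeSet k → MvPolynomial V 𝕜 := fun y => monomial (genExp x y) 1
    have hF : Function.Injective F := fun y1 y2 h =>
      genExp_injective hn hx k (monomial_left_injective one_ne_zero h)
    have hspan : edgeIdeal 𝕜 G ^ (n + 1 + k) ⊔
        Ideal.span (↑(Finset.univ.image F) : Set (MvPolynomial V 𝕜)) =
        symbolicPower (edgeIdeal 𝕜 G) (n + 1 + k) := by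
      rw [hJ, hI]
      unfold monIdeal
      rw [Set.image_union, Ideal.span_union, ← range_genExp, ← Set.range_comp]
      congr 2
      simp [F, Function.comp_def]
    refine ⟨Finset.univ.image F, ?_, ?_, hspan⟩
    · rw [Finset.card_image_of_injective _ hF, Finset.card_univ]
    · rw [← hspan]
      exact fun f hf => Ideal.mem_sup_right (Ideal.subset_span hf)
  unfold sdefect
  apply le_antisymm (Nat.sInf_le hmem)
  apply le_csInf ⟨_, hmem⟩
  rintro m ⟨S, rfl, hSJ, hS⟩
  let L := coeffMap 𝕜 G x k
  have hLI : ∀ f ∈ edgeIdeal 𝕜 G ^ (n + 1 + k), L f = 0 := by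
    intro f hf
    ext y
    rw [coeffMap_apply]
    by_contra hne
    rw [hI, mem_monIdeal] at hf
    obtain ⟨b, hb, hba⟩ := hf _ (mem_support_iff.2 hne)
    have := degree_le_of_le hba
    rw [degree_EdgeExps hb, degree_genExp] at this
    omega
  have hLS : ∀ f ∈ Ideal.span (↑S : Set (MvPolynomial V 𝕜)),
      L f ∈ Submodule.span 𝕜 (↑(S.image L) : Set (Sym G.edgeSet k → 𝕜)) ∧
        f ∈ symbolicPower (edgeIdeal 𝕜 G) (n + 1 + k) := by
    intro f hf
    induction hf using Submodule.span_induction with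
    | mem f hf =>
      exact ⟨Submodule.subset_span (Finset.mem_coe.2 (Finset.mem_image_of_mem L hf)), hSJ hf⟩
    | zero => exact ⟨by rw [map_zero]; exact zero_mem _, zero_mem _⟩
    | add f g _ _ hf hg =>
      exact ⟨by rw [map_add]; exact add_mem hf.1 hg.1, add_mem hf.2 hg.2⟩
    | smul r f _ hf =>
      refine ⟨?_, Ideal.mul_mem_left _ r hf.2⟩
      have : L (r • f) = constantCoeff r • L f := coeffMap_mul k r f (hdegJ f hf.2)
      rw [this]
      exact Submodule.smul_mem _ _ hf.1
  have hsingle : ∀ y : Sym G.edgeSet k, L (monomial (genExp x y) 1) = Pi.single y 1 := by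
    intro y
    ext z
    rw [coeffMap_apply, coeff_monomial, Pi.single_apply]
    simp only [(genExp_injective hn hx k).eq_iff, eq_comm]
  have htop : Submodule.span 𝕜 (↑(S.image L) : Set (Sym G.edgeSet k → 𝕜)) = ⊤ := by
    rw [eq_top_iff, ← (Pi.basisFun 𝕜 (Sym G.edgeSet k)).span_eq, Submodule.span_le]
    rintro _ ⟨y, rfl⟩
    rw [Pi.basisFun_apply, ← hsingle]
    have hy : monomial (genExp x y) (1 : 𝕜) ∈ symbolicPower (edgeIdeal 𝕜 G) (n + 1 + k) := by
      rw [hJ, ← range_genExp]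
      exact Ideal.subset_span ⟨_, Or.inr ⟨y, rfl⟩, rfl⟩
    rw [← hS] at hy
    obtain ⟨f, hf, g, hg, hfg⟩ := Submodule.mem_sup.1 hy
    rw [← hfg, map_add, hLI f hf, zero_add]
    exact (hLS g hg).1
  calc Fintype.card (Sym G.edgeSet k) = Module.finrank 𝕜 (Sym G.edgeSet k → 𝕜) :=
        (Module.finrank_fintype_fun_eq_card 𝕜).symm
    _ = Module.finrank 𝕜 (Submodule.span 𝕜 (↑(S.image L) : Set (Sym G.edgeSet k → 𝕜))) := by
        rw [htop, finrank_top]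
    _ ≤ (S.image L).card := finrank_span_finset_le_card _
    _ ≤ S.card := Finset.card_image_le

end Defect

/-- for the edge ideal `I` of a unicyclic graph with unique odd cycle `C_{2n+1}`
and `l = |E(G)| - (2n+1)`, for `n+1 ≤ s ≤ 2n+1` the symbolic defect is
`sdefect(I,s) = C(2n+l+s-(n+1), s-(n+1))`. -/
theorem unicyclic_sdefect_initial {V : Type} [Fintype V] (𝕜 : Type) [Field 𝕜]
    (G : SimpleGraph V) (n : ℕ) (hn : 1 ≤ n)
    (x : ZMod (2 * n + 1) → V) (hx : IsUnicyclicOddCycle G n x)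
    (l : ℕ) (hl : l = G.edgeSet.ncard - (2 * n + 1))
    (s : ℕ) (hs1 : n + 1 ≤ s) (hs2 : s ≤ 2 * n + 1) :
    sdefect (edgeIdeal 𝕜 G) s = Nat.choose (2 * n + l + s - (n + 1)) (s - (n + 1)) := by
  classical
  rw [sdefect_eq_card hn hx s hs1 hs2, Sym.card_sym_eq_choose]
  have h1 : Fintype.card G.edgeSet = G.edgeSet.ncard := by
    rw [← Nat.card_eq_fintype_card]; rfl
  have h2 : 2 * n + 1 ≤ Fintype.card V := by
    have := Fintype.card_le_of_injective x hx.inj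
    rwa [ZMod.card] at this
  rw [← hx.edge_count] at h2
  rw [h1]
  congr 1
  omega

end
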